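/- For every Δτ > 0 and every t ≥ 0: ∑_{k=κ+1}^∞ λ_k² (1 − e^{-μ_k Δτ})² ∫_0^t e^{-2μ_k(t−τ)} dτ ≤ ((κ+1)²/(2(1+2κ))) · ∑_{k=κ+1}^∞ (1 − e^{-2μ_k Δτ}) / λ_k². -/

import Mathlib

noncomputable def lam (k : ℕ) : ℝ := (k : ℝ) * Real.pi

noncomputable def muK (μ : ℝ) (k : ℕ) : ℝ := lam k ^ 2 * (lam k ^ 2 - μ)

lemma aux_int (a t : ℝ) (ha : 0 < a) :
    ∫ τ in (0:ℝ)..t, Real.exp (-a * (t - τ)) ≤ 1 / a := by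
  have h : ∀ x ∈ Set.uIcc (0:ℝ) t,
      HasDerivAt (fun τ => Real.exp (-a * (t - τ)) / a) (Real.exp (-a * (t - x))) x := by
    intro x _
    have h1 : HasDerivAt (fun τ : ℝ => -a * (t - τ)) (-a * (-1)) x :=
      ((hasDerivAt_id x).const_sub t).const_mul (-a)
    have h2 := h1.exp.div_const a
    have h3 : Real.exp (-a * (t - x)) * (-a * (-1)) / a = Real.exp (-a * (t - x)) := by
      rw [div_eq_iff ha.ne']
      ring
    rw [h3] at h2
    exact h2
  rw [intervalIntegral.integral_eq_sub_of_hasDerivAt h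
    (Continuous.intervalIntegrable (by fun_prop) _ _)]
  have : 0 < Real.exp (-a * (t - 0)) / a := by positivity
  simp only [sub_self, mul_zero, Real.exp_zero]
  linarith

lemma aux_alg (L D E I C : ℝ) (hL : 0 < L) (hD : 0 < D) (hE0 : 0 ≤ E) (hE : E ≤ 1)
    (hI : I ≤ 1 / (2 * (L * D))) (hC : 1 / (2 * D) ≤ C / L) :
    L * (1 - E) ^ 2 * I ≤ C * ((1 - E ^ 2) / L) := by
  calc L * (1 - E) ^ 2 * I ≤ L * (1 - E) ^ 2 * (1 / (2 * (L * D))) := by gcongr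
    _ = (1 - E) ^ 2 * (1 / (2 * D)) := by field_simp
    _ ≤ (1 - E ^ 2) * (1 / (2 * D)) := by
        apply mul_le_mul_of_nonneg_right _ (by positivity)
        nlinarith
    _ ≤ (1 - E ^ 2) * (C / L) := by
        apply mul_le_mul_of_nonneg_left hC
        nlinarith
    _ = _ := by ring

/-- For every `Δt > 0` and every `t ≥ 0`:
`∑_{k=κ+1}^∞ λ_k² (1 − e^{-μ_k Δt})² ∫_0^t e^{-2μ_k(t−τ)} dτ
  ≤ ((κ+1)²/(2(1+2κ))) ∑_{k=κ+1}^∞ (1 − e^{-2μ_k Δt})/λ_k²`,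
where `λ_k = kπ`, `μ_k = λ_k²(λ_k² − μ)` and `(κ−1)²π² ≤ μ < κ²π²`. -/
theorem stmt_15 (μ : ℝ) (κ : ℕ) (hκ : 1 ≤ κ)
    (hμl : ((κ : ℝ) - 1) ^ 2 * Real.pi ^ 2 ≤ μ) (hμu : μ < (κ : ℝ) ^ 2 * Real.pi ^ 2)
    (Δt t : ℝ) (hΔt : 0 < Δt) (ht : 0 ≤ t) :
    ∑' j : ℕ, lam (κ + 1 + j) ^ 2 * (1 - Real.exp (-(muK μ (κ + 1 + j)) * Δt)) ^ 2 *
        ∫ τ in (0:ℝ)..t, Real.exp (-(2 * muK μ (κ + 1 + j)) * (t - τ))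
      ≤ (((κ : ℝ) + 1) ^ 2 / (2 * (1 + 2 * (κ : ℝ)))) *
        ∑' j : ℕ, (1 - Real.exp (-(2 * muK μ (κ + 1 + j)) * Δt)) / lam (κ + 1 + j) ^ 2 := by
  have hpi := Real.pi_pos
  have hκ' : (1:ℝ) ≤ κ := by exact_mod_cast hκ
  have hL : ∀ j : ℕ, 0 < lam (κ + 1 + j) ^ 2 := by
    intro j
    unfold lam
    positivity
  have hkey : ∀ j : ℕ, (1 + 2 * (κ:ℝ)) * lam (κ + 1 + j) ^ 2
      ≤ ((κ:ℝ) + 1) ^ 2 * (lam (κ + 1 + j) ^ 2 - μ) := by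
    intro j
    unfold lam
    push_cast
    have hj : (0:ℝ) ≤ j := Nat.cast_nonneg j
    have h1 : ((κ:ℝ) + 1) ^ 2 ≤ ((κ:ℝ) + 1 + j) ^ 2 := pow_le_pow_left₀ (by positivity) (by linarith) 2
    have h2 := mul_le_mul_of_nonneg_left h1 (show 0 ≤ (κ:ℝ) ^ 2 * Real.pi ^ 2 by positivity)
    have h3 := mul_le_mul_of_nonneg_left hμu.le (show 0 ≤ ((κ:ℝ) + 1) ^ 2 by positivity)
    linarith
  have hD : ∀ j : ℕ, 0 < lam (κ + 1 + j) ^ 2 - μ := by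
    intro j
    have h1 : 0 < (1 + 2 * (κ:ℝ)) * lam (κ + 1 + j) ^ 2 := mul_pos (by positivity) (hL j)
    exact pos_of_mul_pos_right (h1.trans_le (hkey j)) (by positivity)
  have hm : ∀ j : ℕ, 0 < muK μ (κ + 1 + j) := fun j => mul_pos (hL j) (hD j)
  have hterm : ∀ j : ℕ, lam (κ + 1 + j) ^ 2 * (1 - Real.exp (-(muK μ (κ + 1 + j)) * Δt)) ^ 2 *
        (∫ τ in (0:ℝ)..t, Real.exp (-(2 * muK μ (κ + 1 + j)) * (t - τ)))
      ≤ (((κ : ℝ) + 1) ^ 2 / (2 * (1 + 2 * (κ : ℝ)))) *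
        ((1 - Real.exp (-(2 * muK μ (κ + 1 + j)) * Δt)) / lam (κ + 1 + j) ^ 2) := by
    intro j
    have hE : Real.exp (-(2 * muK μ (κ + 1 + j)) * Δt)
        = Real.exp (-(muK μ (κ + 1 + j)) * Δt) ^ 2 := by
      rw [← Real.exp_nat_mul]
      congr 1
      push_cast
      ring
    rw [hE]
    apply aux_alg _ (lam (κ + 1 + j) ^ 2 - μ) _ _ _ (hL j) (hD j) (Real.exp_pos _).le
    · rw [Real.exp_le_one_iff]
      nlinarith [mul_pos (hm j) hΔt]
    · exact aux_int _ t (mul_pos two_pos (hm j))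
    · rw [div_div, div_le_div_iff₀ (mul_pos two_pos (hD j)) (mul_pos (by positivity) (hL j))]
      linarith [hkey j]
  have hR : Summable fun j : ℕ =>
      (1 - Real.exp (-(2 * muK μ (κ + 1 + j)) * Δt)) / lam (κ + 1 + j) ^ 2 := by
    have hs : Summable fun j : ℕ => 1 / lam (κ + 1 + j) ^ 2 := by
      have h0 : Summable fun n : ℕ => 1 / lam n ^ 2 := by
        have h1 : Summable fun n : ℕ => 1 / (n:ℝ) ^ 2 :=
          Real.summable_one_div_nat_pow.mpr one_lt_two
        refine (h1.mul_right (1 / Real.pi ^ 2)).congr ?_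
        intro n
        unfold lam
        rw [mul_pow, one_div_mul_one_div]
      have h2 := (summable_nat_add_iff (κ + 1)).mpr h0
      refine h2.congr ?_
      intro j
      rw [add_comm j]
    refine Summable.of_nonneg_of_le ?_ ?_ hs
    · intro j
      apply div_nonneg _ (hL j).le
      rw [sub_nonneg, Real.exp_le_one_iff]
      nlinarith [mul_pos (hm j) hΔt]
    · intro j
      apply div_le_div_of_nonneg_right _ (hL j).le
      linarith [Real.exp_pos (-(2 * muK μ (κ + 1 + j)) * Δt)]
  have hR' := hR.mul_left (((κ : ℝ) + 1) ^ 2 / (2 * (1 + 2 * (κ : ℝ))))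
  rw [← tsum_mul_left]
  refine Summable.tsum_le_tsum hterm (Summable.of_nonneg_of_le ?_ hterm hR') hR'
  intro j
  apply mul_nonneg (by positivity)
  exact intervalIntegral.integral_nonneg ht fun x _ => (Real.exp_pos _).le
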